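/- Let f : ℝⁿ → ℝ be C³ and define the matrix-valued field χᵢⱼ = ‖∇f‖² ∂ᵢ∂ⱼf + Δf (δᵢⱼ − ∂ᵢf ∂ⱼf). Then for every x ∈ ℝⁿ and every vector V ∈ ℝⁿ: Σᵢⱼ (∂ᵢ χᵢⱼ)(x) Vⱼ = ⟨Hess f(x) · V, ∇(‖∇f‖²)(x)⟩ + (1 + ‖∇f(x)‖²) ⟨∇(Δf)(x), V⟩ − ⟨∇(Δf)(x), ∇f(x)⟩ ⟨V, ∇f(x)⟩ − (Δf(x))² ⟨V, ∇f(x)⟩ − (1/2) Δf(x) ⟨V, ∇(‖∇f‖²)(x)⟩. -/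

import Mathlib

/-- The `i`-th partial derivative `∂ᵢ f` of a function `f : ℝⁿ → ℝ`. -/
noncomputable def pd {n : ℕ} (f : (Fin n → ℝ) → ℝ) (i : Fin n) (x : Fin n → ℝ) : ℝ :=
  fderiv ℝ f x (Pi.single i 1)

/-- The second partial derivative `∂ᵢ ∂ⱼ f` (entry of the Hessian matrix). -/
noncomputable def pd2 {n : ℕ} (f : (Fin n → ℝ) → ℝ) (i j : Fin n) (x : Fin n → ℝ) : ℝ :=
  pd (pd f j) i x

/-- The squared gradient norm `‖∇f‖² = ∑ i, (∂ᵢ f)²`. -/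
noncomputable def gradNormSq {n : ℕ} (f : (Fin n → ℝ) → ℝ) (x : Fin n → ℝ) : ℝ :=
  ∑ i, pd f i x ^ 2

/-- The Euclidean Laplacian `Δf = ∑ i, ∂ᵢ ∂ᵢ f`. -/
noncomputable def lap {n : ℕ} (f : (Fin n → ℝ) → ℝ) (x : Fin n → ℝ) : ℝ :=
  ∑ i, pd2 f i i x

/-- The deformed metric `g̃ᵢⱼ = δᵢⱼ - ∂ᵢf ∂ⱼf` as a matrix. -/
noncomputable def gTilde {n : ℕ} (f : (Fin n → ℝ) → ℝ) (x : Fin n → ℝ) :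
    Matrix (Fin n) (Fin n) ℝ :=
  1 - Matrix.vecMulVec (fun i => pd f i x) (fun i => pd f i x)

/-- The Christoffel symbols `Γ̃ᵏᵢⱼ` of the metric `g̃` in Cartesian coordinates. -/
noncomputable def christoffel {n : ℕ} (f : (Fin n → ℝ) → ℝ) (k i j : Fin n)
    (x : Fin n → ℝ) : ℝ :=
  (1 / 2) * ∑ l, (gTilde f x)⁻¹ k l *
    (pd (fun y => gTilde f y j l) i x + pd (fun y => gTilde f y i l) j x
      - pd (fun y => gTilde f y i j) l x)

/-- The paper's symmetric tensor field
`χᵢⱼ = ‖∇f‖² ∂ᵢ∂ⱼf + Δf (δᵢⱼ - ∂ᵢf ∂ⱼf)` in Cartesian coordinates. -/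
noncomputable def chi {n : ℕ} (f : (Fin n → ℝ) → ℝ) (i j : Fin n) (x : Fin n → ℝ) : ℝ :=
  gradNormSq f x * pd2 f i j x
    + lap f x * ((if i = j then (1 : ℝ) else 0) - pd f i x * pd f j x)

/-- The divergence of the tensor field `χ` evaluated on a vector `V`:
`(div χ)(V) = ∑ i j, (∂ᵢ χᵢⱼ) Vⱼ`. -/
noncomputable def divChi {n : ℕ} (f : (Fin n → ℝ) → ℝ) (V : Fin n → ℝ)
    (x : Fin n → ℝ) : ℝ :=
  ∑ i, ∑ j, pd (fun y => chi f i j y) i x * V j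

theorem ContDiff.pd {n : ℕ} {f : (Fin n → ℝ) → ℝ} {k m : WithTop ℕ∞} (hf : ContDiff ℝ k f)
    (hk : m + 1 ≤ k) (i : Fin n) : ContDiff ℝ m (pd f i) :=
  (hf.fderiv_right hk).clm_apply contDiff_const

theorem pd2_comm {n : ℕ} {f : (Fin n → ℝ) → ℝ} (hf : ContDiff ℝ 2 f) (i j : Fin n)
    (x : Fin n → ℝ) : pd2 f i j x = pd2 f j i x := by
  have hd : DifferentiableAt ℝ (fderiv ℝ f) x :=
    ((hf.fderiv_right (m := 1) (by norm_num)).differentiable one_ne_zero) x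
  have key (a b : Fin n) :
      pd2 f a b x = fderiv ℝ (fderiv ℝ f) x (Pi.single a 1) (Pi.single b 1) := by
    change fderiv ℝ (fun y => fderiv ℝ f y (Pi.single b 1)) x (Pi.single a 1) = _
    rw [fderiv_clm_apply hd (differentiableAt_const _)]
    simp
  rw [key, key]
  exact (hf.contDiffAt.isSymmSndFDerivAt (by simp)) _ _

theorem pd_add {n : ℕ} {f g : (Fin n → ℝ) → ℝ} {x : Fin n → ℝ} (hf : DifferentiableAt ℝ f x)
    (hg : DifferentiableAt ℝ g x) (i : Fin n) :
    pd (fun y => f y + g y) i x = pd f i x + pd g i x := by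
  simp [pd, fderiv_fun_add hf hg]

theorem pd_const_sub {n : ℕ} (f : (Fin n → ℝ) → ℝ) (x : Fin n → ℝ) (c : ℝ) (i : Fin n) :
    pd (fun y => c - f y) i x = -pd f i x := by
  simp [pd, fderiv_const_sub]

theorem pd_mul {n : ℕ} {f g : (Fin n → ℝ) → ℝ} {x : Fin n → ℝ} (hf : DifferentiableAt ℝ f x)
    (hg : DifferentiableAt ℝ g x) (i : Fin n) :
    pd (fun y => f y * g y) i x = f x * pd g i x + pd f i x * g x := by
  simp [pd, fderiv_fun_mul hf hg, mul_comm (g x)]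

theorem pd_sum {n : ℕ} {ι : Type*} (s : Finset ι) {F : ι → (Fin n → ℝ) → ℝ} {x : Fin n → ℝ}
    (hF : ∀ k ∈ s, DifferentiableAt ℝ (F k) x) (i : Fin n) :
    pd (fun y => ∑ k ∈ s, F k y) i x = ∑ k ∈ s, pd (F k) i x := by
  simp [pd, fderiv_fun_sum hF]

theorem pd_gradNormSq {n : ℕ} {f : (Fin n → ℝ) → ℝ} (hf : ContDiff ℝ 2 f) (j : Fin n)
    (x : Fin n → ℝ) : pd (gradNormSq f) j x = 2 * ∑ i, pd f i x * pd2 f i j x := by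
  have hd (i : Fin n) : DifferentiableAt ℝ (pd f i) x :=
    (hf.pd (m := 1) (by norm_num) i).differentiable one_ne_zero x
  have hG : gradNormSq f = fun y => ∑ i, pd f i y * pd f i y := by
    funext y
    simp [gradNormSq, sq]
  rw [hG, pd_sum _ fun i _ => (hd i).fun_mul (hd i), Finset.mul_sum]
  refine Finset.sum_congr rfl fun i _ => ?_
  rw [pd_mul (hd i) (hd i), pd2_comm hf i j, pd2]
  ring

theorem pd_lap {n : ℕ} {f : (Fin n → ℝ) → ℝ} (hf : ContDiff ℝ 3 f) (j : Fin n)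
    (x : Fin n → ℝ) : pd (lap f) j x = ∑ i, pd (pd2 f i j) i x := by
  have h1 (i : Fin n) : ContDiff ℝ 2 (pd f i) := hf.pd (by norm_num) i
  have h2 (i : Fin n) : DifferentiableAt ℝ (pd2 f i i) x :=
    ((h1 i).pd (m := 1) (by norm_num) i).differentiable one_ne_zero x
  change pd (fun y => ∑ i, pd2 f i i y) j x = _
  rw [pd_sum _ fun i _ => h2 i]
  refine Finset.sum_congr rfl fun i _ => ?_
  have hs : pd2 f i j = pd (pd f i) j :=
    funext fun y => pd2_comm (hf.of_le (by norm_num)) i j y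
  rw [hs]
  exact pd2_comm (h1 i) j i x

theorem pd_chi {n : ℕ} {f : (Fin n → ℝ) → ℝ} (hf : ContDiff ℝ 3 f) (i j : Fin n)
    (x : Fin n → ℝ) :
    pd (fun y => chi f i j y) i x
      = pd2 f i j x * pd (gradNormSq f) i x + gradNormSq f x * pd (pd2 f i j) i x
        + pd (lap f) i x * ((if i = j then (1 : ℝ) else 0) - pd f i x * pd f j x)
        - lap f x * (pd2 f i i x * pd f j x + pd f i x * pd2 f i j x) := by
  have h1 (a : Fin n) : ContDiff ℝ 2 (pd f a) := hf.pd (by norm_num) a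
  have d1 (a : Fin n) : DifferentiableAt ℝ (pd f a) x := (h1 a).differentiable two_ne_zero x
  have d2 (a b : Fin n) : DifferentiableAt ℝ (pd2 f a b) x :=
    ((h1 b).pd (m := 1) (by norm_num) a).differentiable one_ne_zero x
  have dG : DifferentiableAt ℝ (gradNormSq f) x :=
    DifferentiableAt.fun_sum fun a _ => (d1 a).fun_pow 2
  have dL : DifferentiableAt ℝ (lap f) x := DifferentiableAt.fun_sum fun a _ => d2 a a
  have dP := (d1 i).fun_mul (d1 j)
  have dQ := dP.const_sub (if i = j then (1 : ℝ) else 0)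
  simp only [chi]
  rw [pd_add (dG.fun_mul (d2 i j)) (dL.fun_mul dQ), pd_mul dG (d2 i j), pd_mul dL dQ,
    pd_const_sub, pd_mul (d1 i) (d1 j)]
  simp only [pd2]
  ring

/-- Flat-space version of Theorem 3.1: for a `C³` function `f : ℝⁿ → ℝ` and the tensor
`χ = ‖∇f‖² Hess f + (Δf)(g - df ⊗ df)`, the divergence `(div χ)(V) = ∑ i j, ∂ᵢχᵢⱼ Vⱼ` equals
`⟨Hess f · V, ∇‖∇f‖²⟩ + (1 + ‖∇f‖²)⟨∇Δf, V⟩ - ⟨∇Δf, ∇f⟩⟨V, ∇f⟩ - (Δf)²⟨V, ∇f⟩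
  - (1/2) Δf ⟨V, ∇‖∇f‖²⟩`. -/
theorem stmt_9 {n : ℕ} (f : (Fin n → ℝ) → ℝ) (hf : ContDiff ℝ 3 f)
    (x : Fin n → ℝ) (V : Fin n → ℝ) :
    divChi f V x
      = (∑ i, (∑ j, pd2 f i j x * V j) * pd (gradNormSq f) i x)
        + (1 + gradNormSq f x) * (∑ i, pd (lap f) i x * V i)
        - (∑ i, pd (lap f) i x * pd f i x) * (∑ i, V i * pd f i x)
        - lap f x ^ 2 * (∑ i, V i * pd f i x)
        - (1 / 2) * lap f x * (∑ i, V i * pd (gradNormSq f) i x) := by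
  have hcol (j : Fin n) : ∑ i, pd (fun y => chi f i j y) i x
      = ∑ i, pd2 f i j x * pd (gradNormSq f) i x + (1 + gradNormSq f x) * pd (lap f) j x
        - (∑ i, pd (lap f) i x * pd f i x) * pd f j x - lap f x ^ 2 * pd f j x
        - (1 / 2) * lap f x * pd (gradNormSq f) j x := by
    have hδ : ∑ i, pd (lap f) i x * (if i = j then (1 : ℝ) else 0) = pd (lap f) j x := by simp
    have hL : ∑ i, pd2 f i i x = lap f x := rfl
    simp only [pd_chi hf, mul_sub, mul_add, Finset.sum_add_distrib, Finset.sum_sub_distrib, hδ,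
      ← Finset.mul_sum, ← mul_assoc, ← Finset.sum_mul, ← pd_lap hf]
    simp only [mul_assoc, ← Finset.mul_sum, hL]
    rw [pd_gradNormSq (hf.of_le (by norm_num)) j]
    ring
  have hswap : ∑ i, (∑ j, pd2 f i j x * V j) * pd (gradNormSq f) i x
      = ∑ j, (∑ i, pd2 f i j x * pd (gradNormSq f) i x) * V j := by
    simp only [Finset.sum_mul]
    rw [Finset.sum_comm]
    exact Finset.sum_congr rfl fun j _ => Finset.sum_congr rfl fun i _ => by ring
  rw [divChi, Finset.sum_comm, hswap]
  simp only [← Finset.sum_mul, hcol]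
  rw [Finset.mul_sum, Finset.mul_sum, Finset.mul_sum, Finset.mul_sum, ← Finset.sum_add_distrib,
    ← Finset.sum_sub_distrib, ← Finset.sum_sub_distrib, ← Finset.sum_sub_distrib]
  exact Finset.sum_congr rfl fun j _ => by ring
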